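/- For all odd primes p < q < r < s, C_{pqrs} ≤ (3/4)·p³q, where C_n denotes the height of the polynomial (X^n − 1)/Φ_n(X). -/

import Mathlib

open Polynomial

/-- The height of an integer polynomial: the maximum of the absolute values of its
coefficients (`0` for the zero polynomial). -/
noncomputable def polyHeight (f : ℤ[X]) : ℕ := f.support.sup fun m => (f.coeff m).natAbs

/-- `C n` is the height of the polynomial `(X^n - 1) / Φ_n(X)` (exact division,
realized via division by the monic polynomial `Φ_n`). -/
noncomputable def Cinv (n : ℕ) : ℕ := polyHeight ((X ^ n - 1) /ₘ cyclotomic n ℤ)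

/-- The geometric sum `1 + X ^ a + X ^ (2 * a) + ⋯` with `k` terms. -/
noncomputable def geomPoly (a k : ℕ) : ℤ[X] := ∑ i ∈ Finset.range k, X ^ (a * i)

theorem geomPoly_mul (a k : ℕ) : geomPoly a k * (X ^ a - 1) = X ^ (a * k) - 1 := by
  simp only [geomPoly, pow_mul]
  exact geom_sum_mul (X ^ a : ℤ[X]) k

theorem expand_geomPoly (r a k : ℕ) : expand ℤ r (geomPoly a k) = geomPoly (r * a) k := by
  simp only [geomPoly, map_sum, map_pow, expand_X, ← pow_mul, mul_assoc]

/-- Multiplying by a geometric sum with `k` terms multiplies coefficient bounds by `k`. -/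
theorem coeff_geomPoly_mul_mem_Icc {f : ℤ[X]} {u v : ℤ} (hu : u ≤ 0) (hv : 0 ≤ v)
    (hf : ∀ n, f.coeff n ∈ Set.Icc u v) (a k n : ℕ) :
    (geomPoly a k * f).coeff n ∈ Set.Icc (k * u) (k * v) := by
  have key : ∀ i, (X ^ (a * i) * f).coeff n ∈ Set.Icc u v := by
    intro i
    rw [coeff_X_pow_mul']
    split_ifs
    · exact hf _
    · exact ⟨hu, hv⟩
  rw [geomPoly, Finset.sum_mul, finsetSum_coeff]
  constructor
  · simpa using Finset.card_nsmul_le_sum (Finset.range k) _ u fun i _ => (key i).1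
  · simpa using Finset.sum_le_card_nsmul (Finset.range k) _ v fun i _ => (key i).2

theorem abs_coeff_geomPoly_mul_le {f : ℤ[X]} {M : ℤ} (hf : ∀ n, |f.coeff n| ≤ M) (a k n : ℕ) :
    |(geomPoly a k * f).coeff n| ≤ k * M := by
  have hM : 0 ≤ M := (abs_nonneg _).trans (hf 0)
  have h := coeff_geomPoly_mul_mem_Icc (neg_nonpos.mpr hM) hM (fun n => abs_le.mp (hf n)) a k n
  exact abs_le.mpr ⟨by linarith [h.1], h.2⟩

theorem abs_coeff_X_pow_mul_le {f : ℤ[X]} {M : ℤ} (hf : ∀ n, |f.coeff n| ≤ M) (d n : ℕ) :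
    |(X ^ d * f).coeff n| ≤ M := by
  rw [coeff_X_pow_mul']
  split_ifs
  · exact hf _
  · simpa using (abs_nonneg _).trans (hf 0)

/-- If `d` exceeds the degree of `f`, multiplying `f` by `X ^ d - 1` does not change its height. -/
theorem abs_coeff_X_pow_sub_one_mul_le {f : ℤ[X]} {M : ℤ} (hf : ∀ n, |f.coeff n| ≤ M) {d : ℕ}
    (hd : f.natDegree < d) (n : ℕ) : |((X ^ d - 1) * f).coeff n| ≤ M := by
  rw [sub_mul, one_mul, coeff_sub, coeff_X_pow_mul']
  split_ifs with h
  · rw [coeff_eq_zero_of_natDegree_lt (hd.trans_le h), sub_zero]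
    exact hf _
  · rw [zero_sub, abs_neg]
    exact hf _

theorem coeff_sum_X_pow_mem_Icc {ι : Type*} {s : Finset ι} {e : ι → ℕ} (he : Set.InjOn e s)
    (n : ℕ) : (∑ i ∈ s, (X : ℤ[X]) ^ e i).coeff n ∈ Set.Icc (0 : ℤ) 1 := by
  classical
  simp only [finsetSum_coeff, coeff_X_pow, Finset.sum_boole, Set.mem_Icc, Nat.cast_nonneg,
    true_and]
  rw [← Nat.cast_one, Nat.cast_le, Finset.card_le_one]
  intro i hi j hj
  rw [Finset.mem_filter] at hi hj
  exact he hi.1 hj.1 (hi.2.symm.trans hj.2)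

theorem exists_mul_add_mul_eq_mul_add_one {p q : ℕ} (hp : 1 < p) (hq : 1 < q)
    (h : p.Coprime q) :
    ∃ a a' b b' : ℕ, a + a' = q ∧ b + b' = p ∧ p * a + q * b = p * q + 1 := by
  obtain ⟨m, hlt, hm⟩ := Nat.exists_mul_mod_eq_one_of_coprime h hq
  obtain ⟨k, hk⟩ : ∃ k, p * m = q * k + 1 :=
    ⟨p * m / q, by rw [← hm, Nat.div_add_mod]⟩
  have hkp : k < p := by
    by_contra! hkp
    nlinarith [Nat.mul_le_mul_left q hkp, Nat.mul_le_mul_left p hlt.le]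
  refine ⟨m, q - m, p - k, k, by omega, by omega, ?_⟩
  obtain ⟨c, rfl⟩ := Nat.exists_eq_add_of_le hkp.le
  rw [hk, Nat.add_sub_cancel_left]
  ring

section Binary

variable {p q : ℕ}

theorem cyclotomic_mul_mul_geomPoly (hp : p.Prime) (hq : q.Prime) (hpq : p ≠ q) :
    cyclotomic (p * q) ℤ * ((X ^ q - 1) * geomPoly 1 p) = X ^ (p * q) - 1 := by
  have := Fact.mk hp
  have h := cyclotomic_expand_eq_cyclotomic_mul hq
    (fun h => hpq ((Nat.prime_dvd_prime_iff_eq hq hp).mp h).symm) ℤ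
  have hg : cyclotomic p ℤ = geomPoly 1 p := by
    rw [cyclotomic_prime]
    simp [geomPoly]
  rw [hg, expand_geomPoly, mul_one] at h
  rw [mul_left_comm, ← h, mul_comm, geomPoly_mul, mul_comm]

theorem cyclotomic_mul_eq_geomPoly (hp : p.Prime) (hq : q.Prime) (hpq : p ≠ q)
    {a a' b b' : ℕ} (ha : a + a' = q) (hb : b + b' = p) (hab : p * a + q * b = p * q + 1) :
    cyclotomic (p * q) ℤ =
      geomPoly p a * geomPoly q b - X * (geomPoly p a' * geomPoly q b') := by
  have hne : ∀ n : ℕ, 0 < n → (X ^ n - 1 : ℤ[X]) ≠ 0 := fun n hn =>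
    (monic_X_pow_sub_C (1 : ℤ) hn.ne').ne_zero
  refine mul_right_cancel₀ (mul_ne_zero (hne p hp.pos) (hne q hq.pos)) ?_
  have h1 : cyclotomic (p * q) ℤ * ((X ^ p - 1) * (X ^ q - 1)) =
      (X ^ (p * q) - 1) * (X - 1) := by
    rw [← cyclotomic_mul_mul_geomPoly hp hq hpq]
    have h := geomPoly_mul 1 p
    rw [pow_one, one_mul] at h
    rw [← h]
    ring
  have hqb : q * b = p * a' + 1 := by subst ha; nlinarith
  have hpa : p * a = q * b' + 1 := by subst hb; nlinarith
  have hpq' : p * q = p * a' + q * b' + 1 := by subst ha; nlinarith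
  rw [h1]
  calc (X ^ (p * q) - 1 : ℤ[X]) * (X - 1)
      = (X ^ (p * a) - 1) * (X ^ (q * b) - 1)
        - X * ((X ^ (p * a') - 1) * (X ^ (q * b') - 1)) := by
        rw [hqb, hpa, hpq']; ring
    _ = _ := by simp only [← geomPoly_mul]; ring

end Binary

/-- The exponents `t + p * (r * i + q * l)` occurring in this product are distinct. -/
theorem coeff_geomPoly_mul_geomPoly_mul_geomPoly_mem_Icc {p q r a : ℕ} (hq : 0 < q)
    (hqr : q.Coprime r) (ha : a ≤ q) (n : ℕ) :
    (geomPoly (r * p) a * (geomPoly 1 p * geomPoly (p * q) r)).coeff n ∈ Set.Icc (0 : ℤ) 1 := by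
  have hexp : geomPoly (r * p) a * (geomPoly 1 p * geomPoly (p * q) r) =
      ∑ x ∈ Finset.range a ×ˢ Finset.range p ×ˢ Finset.range r,
        X ^ (x.2.1 + p * (r * x.1 + q * x.2.2)) := by
    simp only [geomPoly]
    rw [Finset.sum_mul_sum, Finset.sum_mul_sum, Finset.sum_product]
    refine Finset.sum_congr rfl fun i _ => ?_
    rw [Finset.sum_product, ← Finset.mul_sum, Finset.mul_sum]
    refine Finset.sum_congr rfl fun t _ => ?_
    rw [Finset.mul_sum]
    refine Finset.sum_congr rfl fun l _ => ?_
    rw [← pow_add, ← pow_add]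
    congr 1
    ring
  rw [hexp]
  refine coeff_sum_X_pow_mem_Icc ?_ n
  rintro ⟨i, t, l⟩ h ⟨i', t', l'⟩ h' he
  simp only [Finset.coe_product, Finset.coe_range, Set.mem_prod, Set.mem_Iio] at h h' he
  have ht : t = t' := by
    have := congrArg (· % p) he
    simpa [Nat.mod_eq_of_lt h.2.1, Nat.mod_eq_of_lt h'.2.1] using this
  subst ht
  have hp : 0 < p := by omega
  have he' : r * i + q * l = r * i' + q * l' := Nat.eq_of_mul_eq_mul_left hp (by omega)
  have hi : i = i' := by
    have hmod : r * i ≡ r * i' [MOD q] := by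
      have := congrArg (· % q) he'
      simpa [Nat.ModEq] using this
    have := Nat.ModEq.cancel_left_of_coprime hqr hmod
    exact this.eq_of_lt_of_lt (by omega) (by omega)
  subst hi
  have hl : l = l' := Nat.eq_of_mul_eq_mul_left hq (by omega)
  rw [hl]

theorem abs_coeff_cyclotomic_ternary_le {p q r : ℕ} (hp : p.Prime) (hq : q.Prime) (hr : r.Prime)
    (hpq : p ≠ q) (hpr : p ≠ r) (hqr : q ≠ r) (n : ℕ) :
    |(cyclotomic (p * q * r) ℤ).coeff n| ≤ p := by
  obtain ⟨a, a', b, b', ha, hb, hab⟩ := exists_mul_add_mul_eq_mul_add_one hp.one_lt hq.one_lt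
    ((Nat.coprime_primes hp hq).mpr hpq)
  have hdvd : ¬ r ∣ p * q := by
    rw [hr.dvd_mul, Nat.prime_dvd_prime_iff_eq hr hp, Nat.prime_dvd_prime_iff_eq hr hq]
    tauto
  have hexp := cyclotomic_expand_eq_cyclotomic_mul hr hdvd ℤ
  set T := geomPoly 1 p * geomPoly (p * q) r with hT
  set E : ℤ[X] := geomPoly (r * q) b * (geomPoly (r * p) a * T)
    - X ^ r * (geomPoly (r * q) b' * (geomPoly (r * p) a' * T)) with hE
  have hprod : (X ^ (p * q * r) - 1) * cyclotomic (p * q * r) ℤ = (X ^ q - 1) * E := by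
    have h1 : E = expand ℤ r (cyclotomic (p * q) ℤ) * T := by
      rw [cyclotomic_mul_eq_geomPoly hp hq hpq ha hb hab]
      simp only [map_sub, map_mul, expand_geomPoly, expand_X, hE]
      ring
    rw [h1, hexp, ← geomPoly_mul (p * q) r, ← cyclotomic_mul_mul_geomPoly hp hq hpq, hT]
    ring
  have hcop := (Nat.coprime_primes hq hr).mpr hqr
  have h1 := coeff_geomPoly_mul_mem_Icc le_rfl zero_le_one
    (coeff_geomPoly_mul_geomPoly_mul_geomPoly_mem_Icc (p := p) (a := a) hq.pos hcop (by omega))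
    (r * q) b
  have h2 := coeff_geomPoly_mul_mem_Icc le_rfl zero_le_one
    (coeff_geomPoly_mul_geomPoly_mul_geomPoly_mem_Icc (p := p) (a := a') hq.pos hcop (by omega))
    (r * q) b'
  simp only [mul_zero, mul_one, ← hT, Set.mem_Icc] at h1 h2
  have hEc : ∀ n, -(b' : ℤ) ≤ E.coeff n ∧ E.coeff n ≤ b := by
    intro n
    rw [hE, coeff_sub, coeff_X_pow_mul']
    have := h1 n
    split_ifs
    · have := h2 (n - r)
      constructor <;> linarith
    · constructor <;> linarith
  have hbp : (b : ℤ) + b' = p := by exact_mod_cast hb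
  have hdeg : (cyclotomic (p * q * r) ℤ).natDegree < p * q * r := by
    rw [natDegree_cyclotomic]
    refine Nat.totient_lt _ ?_
    have := Nat.mul_le_mul (Nat.mul_le_mul hp.two_le hq.two_le) hr.two_le
    omega
  by_cases hn : n < p * q * r
  · have hc := congrArg (fun f => f.coeff n) hprod
    simp only [sub_mul, one_mul, coeff_sub, coeff_X_pow_mul'] at hc
    rw [if_neg (by omega), zero_sub] at hc
    rw [← abs_neg, hc, abs_le]
    have h3 := hEc n
    split_ifs
    · have := hEc (n - q)
      constructor <;> linarith
    · constructor <;> linarith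
  · rw [coeff_eq_zero_of_natDegree_lt (by omega)]
    simp

theorem X_pow_sub_one_divByMonic_cyclotomic {p q r s : ℕ} (hp : p.Prime) (hq : q.Prime)
    (hr : r.Prime) (hs : s.Prime) (hpq : p < q) (hqr : q < r) (hrs : r < s) :
    (X ^ (p * q * r * s) - 1) /ₘ cyclotomic (p * q * r * s) ℤ =
      expand ℤ s (cyclotomic (p * q) ℤ) *
        (geomPoly (s * r) p * ((X ^ (s * r * q) - 1) * cyclotomic (p * q * r) ℤ)) := by
  have hr' : ¬ r ∣ p * q := by
    rw [hr.dvd_mul, Nat.prime_dvd_prime_iff_eq hr hp, Nat.prime_dvd_prime_iff_eq hr hq]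
    omega
  have hs' : ¬ s ∣ p * q * r := by
    rw [hs.dvd_mul, hs.dvd_mul, Nat.prime_dvd_prime_iff_eq hs hp,
      Nat.prime_dvd_prime_iff_eq hs hq, Nat.prime_dvd_prime_iff_eq hs hr]
    omega
  have er := congrArg (expand ℤ s) (cyclotomic_expand_eq_cyclotomic_mul hr hr' ℤ)
  have es := cyclotomic_expand_eq_cyclotomic_mul hs hs' ℤ
  have h := congrArg (fun f => expand ℤ s (expand ℤ r f)) (cyclotomic_mul_mul_geomPoly hp hq hpq.ne)
  simp only [map_mul, map_sub, map_pow, map_one, expand_X, expand_geomPoly, ← pow_mul,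
    mul_one] at h er
  have hn : s * (r * (p * q)) = p * q * r * s := by ring
  rw [er, es, hn, ← mul_assoc s r q] at h
  rw [← h, show ∀ u v w x y : ℤ[X], u * v * w * (x * y) = u * (w * (y * (x * v))) from
    fun u v w x y => by ring, mul_divByMonic_cancel_left _ (cyclotomic.monic _ ℤ)]

/-- If `a / q + b / p = 1 + 1 / (p * q)` then the number `a * b + a' * b'` of monomials of
`Φ_{pq}` is at most `3 / 4 * p * q`. -/
theorem four_mul_mul_add_mul_le {p q a a' b b' : ℕ} (hp : 1 < p) (hq : 1 < q) (ha : a + a' = q)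
    (hb : b + b' = p) (hab : p * a + q * b = p * q + 1) :
    4 * (a * b + a' * b') ≤ 3 * (p * q) := by
  have hN : a * b + a' * b' + 1 = 2 * (a * b) := by subst ha hb; nlinarith
  have hpq : 4 ≤ p * q := Nat.mul_le_mul hp hq
  have hsq : 4 * (p * q) * (a * b) ≤ (p * q + 1) ^ 2 := by
    rw [← hab]
    zify
    nlinarith [sq_nonneg ((p * a : ℤ) - q * b)]
  by_contra! hlt
  have h3 : 3 * (p * q) + 5 ≤ 8 * (a * b) := by omega
  nlinarith [Nat.mul_le_mul_left (p * q) h3]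

/-- **(Bzdęga, bound (6)).** For odd primes `p < q < r < s`, `C (pqrs) ≤ (3/4)·p³q`. -/
theorem height_cyclotomic_stmt12 (p q r s : ℕ)
    (hp : p.Prime) (hq : q.Prime) (hr : r.Prime) (hs : s.Prime)
    (hop : Odd p) (hoq : Odd q) (hor : Odd r) (hos : Odd s)
    (hpq : p < q) (hqr : q < r) (hrs : r < s) :
    (Cinv (p * q * r * s) : ℝ) ≤ (3 / 4) * (p : ℝ) ^ 3 * q := by
  obtain ⟨a, a', b, b', ha, hb, hab⟩ := exists_mul_add_mul_eq_mul_add_one hp.one_lt hq.one_lt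
    ((Nat.coprime_primes hp hq).mpr hpq.ne)
  set g := geomPoly (s * r) p * ((X ^ (s * r * q) - 1) * cyclotomic (p * q * r) ℤ) with hg
  have hdeg : (cyclotomic (p * q * r) ℤ).natDegree < s * r * q := by
    rw [natDegree_cyclotomic]
    calc (p * q * r).totient ≤ p * q * r := Nat.totient_le _
      _ < s * (q * r) := by
        rw [mul_assoc]
        exact Nat.mul_lt_mul_of_pos_right (by omega) (Nat.mul_pos hq.pos hr.pos)
      _ = s * r * q := by ring
  have hgb : ∀ n, |g.coeff n| ≤ (p * p : ℤ) := abs_coeff_geomPoly_mul_le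
    (abs_coeff_X_pow_sub_one_mul_le
      (abs_coeff_cyclotomic_ternary_le hp hq hr hpq.ne (hpq.trans hqr).ne hqr.ne) hdeg) _ _
  have hbound : ∀ n, |((X ^ (p * q * r * s) - 1) /ₘ cyclotomic (p * q * r * s) ℤ).coeff n| ≤
      ((a * b + a' * b') * (p * p) : ℤ) := by
    intro n
    rw [X_pow_sub_one_divByMonic_cyclotomic hp hq hr hs hpq hqr hrs, ← hg,
      cyclotomic_mul_eq_geomPoly hp hq hpq.ne ha hb hab]
    simp only [map_sub, map_mul, expand_geomPoly, expand_X]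
    rw [sub_mul, mul_assoc, mul_assoc, mul_assoc, coeff_sub]
    have h1 := abs_coeff_geomPoly_mul_le (abs_coeff_geomPoly_mul_le hgb (s * q) b) (s * p) a n
    have h2 := abs_coeff_X_pow_mul_le
      (abs_coeff_geomPoly_mul_le (abs_coeff_geomPoly_mul_le hgb (s * q) b') (s * p) a') s n
    refine (abs_sub _ _).trans ((add_le_add h1 h2).trans_eq ?_)
    ring
  have hC : Cinv (p * q * r * s) ≤ (a * b + a' * b') * (p * p) := by
    refine Finset.sup_le fun n _ => ?_
    zify
    exact hbound n
  have hN := four_mul_mul_add_mul_le hp.one_lt hq.one_lt ha hb hab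
  have hfin : 4 * Cinv (p * q * r * s) ≤ 3 * (p ^ 3 * q) := by
    calc 4 * Cinv (p * q * r * s) ≤ 4 * (a * b + a' * b') * (p * p) := by
          rw [mul_assoc 4]
          exact Nat.mul_le_mul_left 4 hC
      _ ≤ 3 * (p * q) * (p * p) := Nat.mul_le_mul_right _ hN
      _ = 3 * (p ^ 3 * q) := by ring
  have hreal : (4 : ℝ) * Cinv (p * q * r * s) ≤ 3 * ((p : ℝ) ^ 3 * q) := by exact_mod_cast hfin
  linarith
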